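/- arXiv:0903.3391 — 2 statements merged into one kernel-verified Lean document; each statement's English description precedes it below -/
import Mathlib

section
/- Let R = ℂ[y₀, y₁, y₂, …, x₁, x₂, …] be the polynomial ring over ℂ in commuting variables yᵢ (i ≥ 0) and xⱼ (j ≥ 1), and let D be the unique derivation on R with D(yᵢ) = y_{i+1}·x₁ for i ≥ 0 and D(xⱼ) = x_{j+1} for j ≥ 1. Let (Bᵢ)_{i≥1} be a sequence of complex numbers with B₁ ≠ 0, and let φ_B : R → ℂ[x] be the ℂ-algebra homomorphism determined by φ_B(yⱼ) = 1 for j ≥ 0 and φ_B(xᵢ) = Bᵢ·x for i ≥ 1. Then for every n ≥ 0, the polynomial φ_B(Dⁿ(y₀)) ∈ ℂ[x] has degree exactly n and its leading coefficient (the coefficient of xⁿ) equals B₁ⁿ. -/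
/-- `R = ℂ[y₀, y₁, y₂, …, x₁, x₂, …]`, the polynomial ring over `ℂ` in commuting
variables `yᵢ` (`i ≥ 0`) and `xⱼ` (`j ≥ 1`): the index `Sum.inl i` stands for `yᵢ`
and `Sum.inr j` stands for `x_{j+1}`. -/
abbrev UmbralRing : Type := MvPolynomial (ℕ ⊕ ℕ) ℂ

open MvPolynomial in
/-- `UmbralFiltration k p` says that `p` is a linear combination of products of exactly one
variable `yᵢ` with at most `k` variables `xⱼ`. -/
inductive UmbralFiltration : ℕ → UmbralRing → Prop
  | zero : UmbralFiltration 0 0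
  | y (i : ℕ) : UmbralFiltration 0 (X (Sum.inl i))
  | mul_x {k : ℕ} {p : UmbralRing} (j : ℕ) (hp : UmbralFiltration k p) :
      UmbralFiltration (k + 1) (p * X (Sum.inr j))
  | add {k : ℕ} {p q : UmbralRing} (hp : UmbralFiltration k p) (hq : UmbralFiltration k q) :
      UmbralFiltration k (p + q)
  | nsmul {k : ℕ} {p : UmbralRing} (c : ℕ) (hp : UmbralFiltration k p) :
      UmbralFiltration k (c • p)
  | succ {k : ℕ} {p : UmbralRing} (hp : UmbralFiltration k p) : UmbralFiltration (k + 1) p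

namespace UmbralFiltration

open MvPolynomial

lemma y_mul_x_pow (i j k : ℕ) :
    UmbralFiltration k (X (Sum.inl i) * X (Sum.inr j) ^ k) := by
  induction k with
  | zero => simpa using y i
  | succ k ih => simpa [pow_succ, mul_assoc] using ih.mul_x j

lemma derivation {D : Derivation ℂ UmbralRing UmbralRing}
    (hDy : ∀ i : ℕ, D (X (Sum.inl i)) = X (Sum.inl (i + 1)) * X (Sum.inr 0))
    (hDx : ∀ j : ℕ, D (X (Sum.inr j)) = X (Sum.inr (j + 1)))
    {k : ℕ} {p : UmbralRing} (hp : UmbralFiltration k p) : UmbralFiltration (k + 1) (D p) := by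
  induction hp with
  | zero => simpa using zero.succ
  | y i => simpa [hDy] using (y (i + 1)).mul_x 0
  | @mul_x k p j hp ih =>
    have h : D (p * X (Sum.inr j)) = p * X (Sum.inr (j + 1)) + D p * X (Sum.inr j) := by
      rw [D.leibniz, hDx, smul_eq_mul, smul_eq_mul, mul_comm (X _) (D p)]
    rw [h]
    exact (hp.mul_x (j + 1)).succ.add (ih.mul_x j)
  | add _ _ ihp ihq => simpa using ihp.add ihq
  | nsmul c _ ih =>
    rw [map_nsmul]
    exact ih.nsmul c
  | succ _ ih => exact ih.succ

lemma natDegree_le {B : ℕ → ℂ} {φ : UmbralRing →ₐ[ℂ] Polynomial ℂ}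
    (hφy : ∀ i : ℕ, φ (X (Sum.inl i)) = 1)
    (hφx : ∀ j : ℕ, φ (X (Sum.inr j)) = Polynomial.C (B (j + 1)) * Polynomial.X)
    {k : ℕ} {p : UmbralRing} (hp : UmbralFiltration k p) : (φ p).natDegree ≤ k := by
  induction hp with
  | zero => simp
  | y i => simp [hφy]
  | mul_x j _ ih =>
    rw [map_mul, hφx]
    exact Polynomial.natDegree_mul_le_of_le ih
      ((Polynomial.natDegree_C_mul_le _ _).trans Polynomial.natDegree_X_le)
  | add _ _ ihp ihq =>
    rw [map_add]
    exact Polynomial.natDegree_add_le_of_degree_le ihp ihq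
  | nsmul c _ ih =>
    rw [map_nsmul]
    exact (Polynomial.natDegree_smul_le c _).trans ih
  | succ _ ih => exact ih.trans (Nat.le_succ _)

/-- The top part of `D^(n+1) (y₀)` is `y_{n+1} x₁^(n+1)`. -/
lemma exists_iterate_eq_add {D : Derivation ℂ UmbralRing UmbralRing}
    (hDy : ∀ i : ℕ, D (X (Sum.inl i)) = X (Sum.inl (i + 1)) * X (Sum.inr 0))
    (hDx : ∀ j : ℕ, D (X (Sum.inr j)) = X (Sum.inr (j + 1))) (n : ℕ) :
    ∃ p, UmbralFiltration n p ∧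
      (⇑D)^[n + 1] (X (Sum.inl 0)) = X (Sum.inl (n + 1)) * X (Sum.inr 0) ^ (n + 1) + p := by
  induction n with
  | zero => exact ⟨0, zero, by simp [hDy]⟩
  | succ n ih =>
    obtain ⟨p, hp, h⟩ := ih
    refine ⟨_, (((y_mul_x_pow (n + 1) 0 n).mul_x 1).nsmul (n + 1)).add
      (hp.derivation hDy hDx), ?_⟩
    rw [Function.iterate_succ_apply', h, map_add, D.leibniz, D.leibniz_pow, hDy, hDx]
    simp only [smul_eq_mul, nsmul_eq_mul, Nat.add_sub_cancel, zero_add]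
    ring

end UmbralFiltration

/-- If `D` is the derivation on `R` with `D(yᵢ) = y_{i+1}·x₁` and `D(xⱼ) = x_{j+1}`,
`(Bᵢ)_{i≥1}` is a sequence in `ℂ` with `B₁ ≠ 0`, and `φ_B : R → ℂ[x]` is the ℂ-algebra
homomorphism with `φ_B(yⱼ) = 1` and `φ_B(xᵢ) = Bᵢ·x`, then for every `n ≥ 0` the
polynomial `φ_B(Dⁿ(y₀))` has degree exactly `n` with leading coefficient `B₁ⁿ`. -/
theorem umbral_degree_leadingCoeff
    (D : Derivation ℂ UmbralRing UmbralRing)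
    (hDy : ∀ i : ℕ, D (MvPolynomial.X (Sum.inl i)) =
      MvPolynomial.X (Sum.inl (i + 1)) * MvPolynomial.X (Sum.inr 0))
    (hDx : ∀ j : ℕ, D (MvPolynomial.X (Sum.inr j)) = MvPolynomial.X (Sum.inr (j + 1)))
    (B : ℕ → ℂ) (hB : B 1 ≠ 0)
    (φ : UmbralRing →ₐ[ℂ] Polynomial ℂ)
    (hφy : ∀ i : ℕ, φ (MvPolynomial.X (Sum.inl i)) = 1)
    (hφx : ∀ j : ℕ, φ (MvPolynomial.X (Sum.inr j)) =
      Polynomial.C (B (j + 1)) * Polynomial.X)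
    (n : ℕ) :
    (φ ((⇑D)^[n] (MvPolynomial.X (Sum.inl 0)))).degree = n ∧
      (φ ((⇑D)^[n] (MvPolynomial.X (Sum.inl 0)))).coeff n = (B 1) ^ n := by
  cases n with
  | zero => simp [hφy]
  | succ n =>
    obtain ⟨p, hp, h⟩ := UmbralFiltration.exists_iterate_eq_add hDy hDx n
    have hlt : (φ p).natDegree < n + 1 := Nat.lt_succ_of_le (hp.natDegree_le hφy hφx)
    have hφ : φ ((⇑D)^[n + 1] (MvPolynomial.X (Sum.inl 0))) =
        Polynomial.C (B 1 ^ (n + 1)) * Polynomial.X ^ (n + 1) + φ p := by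
      rw [h, map_add, map_mul, map_pow, hφy, hφx, one_mul, mul_pow, Polynomial.C_pow]
    have hcoeff : (φ ((⇑D)^[n + 1] (MvPolynomial.X (Sum.inl 0)))).coeff (n + 1) =
        B 1 ^ (n + 1) := by
      rw [hφ, Polynomial.coeff_add, Polynomial.coeff_C_mul_X_pow, if_pos rfl,
        Polynomial.coeff_eq_zero_of_natDegree_lt hlt, add_zero]
    refine ⟨Polynomial.degree_eq_of_le_of_coeff_ne_zero ?_ ?_, hcoeff⟩
    · rw [hφ]
      exact Polynomial.degree_add_le_of_degree_le (Polynomial.degree_C_mul_X_pow_le _ _)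
        (Polynomial.degree_le_of_natDegree_le hlt.le)
    · rw [hcoeff]
      exact pow_ne_zero _ hB
end

section
/- (Existence and uniqueness of the umbral shift) Let R = ℂ[y₀, y₁, y₂, …, x₁, x₂, …] be the polynomial ring over ℂ in commuting variables yᵢ (i ≥ 0) and xⱼ (j ≥ 1), and let D be the unique derivation on R with D(yᵢ) = y_{i+1}·x₁ for i ≥ 0 and D(xⱼ) = x_{j+1} for j ≥ 1. Let (Bᵢ)_{i≥1} be a sequence of complex numbers with B₁ ≠ 0, and let φ_B : R → ℂ[x] be the ℂ-algebra homomorphism determined by φ_B(yⱼ) = 1 for j ≥ 0 and φ_B(xᵢ) = Bᵢ·x for i ≥ 1. Then there exists a unique ℂ-linear map D_B : ℂ[x] → ℂ[x] satisfying D_Bⁿ(φ_B(y₀)) = φ_B(Dⁿ(y₀)) for all n ≥ 0. -/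
/-- `XDegreeLE d p` says that `p` has total degree at most `d` in the variables `xⱼ`. -/
inductive XDegreeLE : ℕ → UmbralRing → Prop
  | scalar (c : ℂ) : XDegreeLE 0 (MvPolynomial.C c)
  | y (i : ℕ) : XDegreeLE 0 (MvPolynomial.X (Sum.inl i))
  | x (j : ℕ) : XDegreeLE 1 (MvPolynomial.X (Sum.inr j))
  | add {d : ℕ} {p q : UmbralRing} : XDegreeLE d p → XDegreeLE d q → XDegreeLE d (p + q)
  | mul {d e : ℕ} {p q : UmbralRing} :
      XDegreeLE d p → XDegreeLE e q → XDegreeLE (d + e) (p * q)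
  | mono {d e : ℕ} {p : UmbralRing} : d ≤ e → XDegreeLE d p → XDegreeLE e p

namespace XDegreeLE

theorem zero (d : ℕ) : XDegreeLE d 0 := by
  simpa using mono (Nat.zero_le d) (scalar 0)

theorem x_pow (j n : ℕ) : XDegreeLE n (MvPolynomial.X (Sum.inr j) ^ n) := by
  induction n with
  | zero => simpa using scalar 1
  | succ n ih => simpa [pow_succ] using mul ih (x j)

/-- The derivation raises the degree in the `xⱼ` by at most one. -/
theorem derivation {D : Derivation ℂ UmbralRing UmbralRing}
    (hDy : ∀ i : ℕ, D (MvPolynomial.X (Sum.inl i)) =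
      MvPolynomial.X (Sum.inl (i + 1)) * MvPolynomial.X (Sum.inr 0))
    (hDx : ∀ j : ℕ, D (MvPolynomial.X (Sum.inr j)) = MvPolynomial.X (Sum.inr (j + 1)))
    {d : ℕ} {p : UmbralRing} (h : XDegreeLE d p) : XDegreeLE (d + 1) (D p) := by
  induction h with
  | scalar c => simpa [MvPolynomial.derivation_C] using zero 1
  | y i => simpa [hDy] using mul (y (i + 1)) (x 0)
  | x j => rw [hDx]; exact mono (by lia) (x _)
  | add _ _ ihp ihq => rw [map_add]; exact add ihp ihq
  | mul hp hq ihp ihq =>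
    rw [Derivation.leibniz, smul_eq_mul, smul_eq_mul]
    exact add (mono (by lia) (mul hp ihq)) (mono (by lia) (mul hq ihp))
  | mono hde _ ih => exact mono (by lia) ih

theorem natDegree_le {B : ℕ → ℂ} {φ : UmbralRing →ₐ[ℂ] Polynomial ℂ}
    (hφy : ∀ i : ℕ, φ (MvPolynomial.X (Sum.inl i)) = 1)
    (hφx : ∀ j : ℕ, φ (MvPolynomial.X (Sum.inr j)) =
      Polynomial.C (B (j + 1)) * Polynomial.X)
    {d : ℕ} {p : UmbralRing} (h : XDegreeLE d p) : (φ p).natDegree ≤ d := by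
  induction h with
  | scalar c =>
    rw [← MvPolynomial.algebraMap_eq, AlgHom.commutes, Polynomial.algebraMap_eq,
      Polynomial.natDegree_C]
  | y i => simp [hφy]
  | x j => rw [hφx]; exact Polynomial.natDegree_C_mul_le _ _ |>.trans Polynomial.natDegree_X_le
  | add _ _ ihp ihq => rw [map_add]; exact Polynomial.natDegree_add_le_of_degree_le ihp ihq
  | mul _ _ ihp ihq => rw [map_mul]; exact Polynomial.natDegree_mul_le_of_le ihp ihq
  | mono hde _ ih => exact ih.trans hde

end XDegreeLE

/-- The leading term of `Dⁿ⁺¹(y₀)` with respect to the degree in the `xⱼ` is `y_{n+1} x₁ⁿ⁺¹`. -/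
theorem exists_iterate_derivation_eq_add {D : Derivation ℂ UmbralRing UmbralRing}
    (hDy : ∀ i : ℕ, D (MvPolynomial.X (Sum.inl i)) =
      MvPolynomial.X (Sum.inl (i + 1)) * MvPolynomial.X (Sum.inr 0))
    (hDx : ∀ j : ℕ, D (MvPolynomial.X (Sum.inr j)) = MvPolynomial.X (Sum.inr (j + 1)))
    (n : ℕ) : ∃ r : UmbralRing, XDegreeLE n r ∧
      (⇑D)^[n + 1] (MvPolynomial.X (Sum.inl 0)) =
        MvPolynomial.X (Sum.inl (n + 1)) * MvPolynomial.X (Sum.inr 0) ^ (n + 1) + r := by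
  induction n with
  | zero => exact ⟨0, .zero 0, by simp [hDy]⟩
  | succ n ih =>
    obtain ⟨r, hr, h⟩ := ih
    refine ⟨MvPolynomial.C ((n : ℂ) + 1) * MvPolynomial.X (Sum.inl (n + 1)) *
      (MvPolynomial.X (Sum.inr 0) ^ n * MvPolynomial.X (Sum.inr 1)) + D r,
      .add (.mono (by lia) (.mul (.mul (.scalar _) (.y _)) (.mul (.x_pow 0 n) (.x 1))))
        (hr.derivation hDy hDx), ?_⟩
    rw [Function.iterate_succ_apply', h, map_add, Derivation.leibniz, Derivation.leibniz_pow,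
      hDy, hDx]
    simp only [smul_eq_mul, nsmul_eq_mul, Nat.add_sub_cancel, map_add, map_natCast, map_one]
    push_cast
    ring

theorem degree_map_iterate_derivation {D : Derivation ℂ UmbralRing UmbralRing}
    (hDy : ∀ i : ℕ, D (MvPolynomial.X (Sum.inl i)) =
      MvPolynomial.X (Sum.inl (i + 1)) * MvPolynomial.X (Sum.inr 0))
    (hDx : ∀ j : ℕ, D (MvPolynomial.X (Sum.inr j)) = MvPolynomial.X (Sum.inr (j + 1)))
    {B : ℕ → ℂ} (hB : B 1 ≠ 0) {φ : UmbralRing →ₐ[ℂ] Polynomial ℂ}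
    (hφy : ∀ i : ℕ, φ (MvPolynomial.X (Sum.inl i)) = 1)
    (hφx : ∀ j : ℕ, φ (MvPolynomial.X (Sum.inr j)) =
      Polynomial.C (B (j + 1)) * Polynomial.X) (n : ℕ) :
    (φ ((⇑D)^[n] (MvPolynomial.X (Sum.inl 0)))).degree = n := by
  cases n with
  | zero => simp [hφy]
  | succ n =>
    obtain ⟨r, hr, h⟩ := exists_iterate_derivation_eq_add hDy hDx n
    have hlead : (φ (MvPolynomial.X (Sum.inl (n + 1)) *
        MvPolynomial.X (Sum.inr 0) ^ (n + 1))).degree = ((n + 1 : ℕ) : WithBot ℕ) := by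
      rw [map_mul, map_pow, hφy, hφx, one_mul, mul_pow, ← Polynomial.C_pow,
        Polynomial.degree_C_mul_X_pow _ (pow_ne_zero _ hB)]
    rw [h, map_add, Polynomial.degree_add_eq_left_of_degree_lt, hlead]
    rw [hlead]
    refine (Polynomial.degree_le_of_natDegree_le (hr.natDegree_le hφy hφx)).trans_lt ?_
    exact_mod_cast Nat.lt_succ_self n

/-- Existence and uniqueness of the umbral shift: if `D` is the derivation on `R` with
`D(yᵢ) = y_{i+1}·x₁` and `D(xⱼ) = x_{j+1}`, `(Bᵢ)_{i≥1}` is a sequence in `ℂ` with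
`B₁ ≠ 0`, and `φ_B : R → ℂ[x]` is the ℂ-algebra homomorphism with `φ_B(yⱼ) = 1` and
`φ_B(xᵢ) = Bᵢ·x`, then there is a unique ℂ-linear map `D_B : ℂ[x] → ℂ[x]` with
`D_Bⁿ(φ_B(y₀)) = φ_B(Dⁿ(y₀))` for all `n ≥ 0`. -/
theorem umbral_shift_exists_unique
    (D : Derivation ℂ UmbralRing UmbralRing)
    (hDy : ∀ i : ℕ, D (MvPolynomial.X (Sum.inl i)) =
      MvPolynomial.X (Sum.inl (i + 1)) * MvPolynomial.X (Sum.inr 0))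
    (hDx : ∀ j : ℕ, D (MvPolynomial.X (Sum.inr j)) = MvPolynomial.X (Sum.inr (j + 1)))
    (B : ℕ → ℂ) (hB : B 1 ≠ 0)
    (φ : UmbralRing →ₐ[ℂ] Polynomial ℂ)
    (hφy : ∀ i : ℕ, φ (MvPolynomial.X (Sum.inl i)) = 1)
    (hφx : ∀ j : ℕ, φ (MvPolynomial.X (Sum.inr j)) =
      Polynomial.C (B (j + 1)) * Polynomial.X) :
    ∃! DB : Polynomial ℂ →ₗ[ℂ] Polynomial ℂ,
      ∀ n : ℕ,
        (⇑DB)^[n] (φ (MvPolynomial.X (Sum.inl 0))) =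
          φ ((⇑D)^[n] (MvPolynomial.X (Sum.inl 0))) := by
  let S : Polynomial.Sequence ℂ :=
    { elems' := fun n => φ ((⇑D)^[n] (MvPolynomial.X (Sum.inl 0)))
      degree_eq' := degree_map_iterate_derivation hDy hDx hB hφy hφx }
  let b := S.basis fun n => (Polynomial.leadingCoeff_ne_zero.mpr (S.ne_zero n)).isUnit
  have hb (n : ℕ) : b n = φ ((⇑D)^[n] (MvPolynomial.X (Sum.inl 0))) := by
    simp only [b, Polynomial.Sequence.basis_eq_self]
    rfl
  refine ⟨b.constr ℂ fun n => b (n + 1), fun n => ?_, fun E hE => b.ext fun n => ?_⟩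
  · induction n with
    | zero => rfl
    | succ n ih =>
      rw [Function.iterate_succ_apply', ih, ← hb, Module.Basis.constr_basis, hb]
  · rw [Module.Basis.constr_basis, hb, hb, ← hE, ← hE, Function.iterate_succ_apply']
end
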